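/- arXiv:math/0303355 — 2 statements merged into one kernel-verified Lean document; each statement's English description precedes it below -/
import Mathlib

section
/- Let X be the complex plane with the integers removed and S the punctured complex plane. The space O(X,S) of holomorphic maps from X to S with the compact-open topology has uncountably many path components. -/
noncomputable section
open scoped Manifold
open TopologicalSpace

/-- The complex plane with the integers removed. -/
def planeMinusIntegers : Opens ℂ := ⟨{z : ℂ | ∀ n : ℤ, z ≠ (n : ℂ)}, by
  have h1 : {z : ℂ | ∀ n : ℤ, z ≠ (n : ℂ)} = (Set.range ((↑) : ℤ → ℂ))ᶜ := by
    ext z; simp [Set.mem_range, not_exists, eq_comm]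
  have h2 : IsClosed (Set.range ((↑) : ℤ → ℂ)) := by
    have h3 : Set.range ((↑) : ℤ → ℂ) = Complex.ofReal '' Set.range ((↑) : ℤ → ℝ) := by
      ext z
      simp only [Set.mem_range, Set.mem_image]
      constructor
      · rintro ⟨n, rfl⟩; exact ⟨n, ⟨n, rfl⟩, by push_cast; ring⟩
      · rintro ⟨x, ⟨n, rfl⟩, rfl⟩; exact ⟨n, by push_cast; ring⟩
    rw [h3]
    exact Complex.isometry_ofReal.isClosedEmbedding.isClosedMap _
      Int.isClosedEmbedding_coe_real.isClosed_range
  rw [h1]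
  exact h2.isOpen_compl⟩

/-- The punctured complex plane. -/
def puncturedPlane : Opens ℂ := ⟨{z : ℂ | z ≠ 0}, isOpen_compl_singleton⟩

/-- The space of holomorphic maps `ℂ ∖ ℤ → ℂ ∖ {0}`, topologized as a subspace of the
space of continuous maps with the compact-open topology. -/
def HoloMaps : Type :=
  {f : C(planeMinusIntegers, puncturedPlane) //
    MDifferentiable 𝓘(ℂ, ℂ) 𝓘(ℂ, ℂ) (f : planeMinusIntegers → puncturedPlane)}

instance : TopologicalSpace HoloMaps :=
  instTopologicalSpaceSubtype

open Classical in
def cf (A : Set ℕ) (n : ℕ) : ℂ := if n ∈ A then -(1/2)^n else 0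

def PA (A : Set ℕ) (z : ℂ) : ℂ := ∏' n, (1 + cf A n * z)

lemma cf_norm_le (A : Set ℕ) (n : ℕ) : ‖cf A n‖ ≤ (1/2 : ℝ)^n := by
  unfold cf
  split_ifs <;> simp

lemma cf_summable (A : Set ℕ) (z : ℂ) : Summable (fun n => ‖cf A n * z‖) := by
  refine Summable.of_nonneg_of_le (fun n => norm_nonneg _) (fun n => ?_)
    (summable_geometric_two.mul_right ‖z‖)
  rw [norm_mul]
  exact mul_le_mul_of_nonneg_right (cf_norm_le A n) (norm_nonneg _)

lemma PA_diff (A : Set ℕ) : Differentiable ℂ (PA A) := by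
  intro z
  have h := Summable.hasProdLocallyUniformlyOn_one_add (f := fun n z => cf A n * z)
    (K := Metric.ball (0:ℂ) (‖z‖ + 1)) Metric.isOpen_ball
    (summable_geometric_two.mul_right (‖z‖ + 1))
    (Filter.Eventually.of_forall fun n x hx => by
      rw [norm_mul]
      have : ‖x‖ ≤ ‖z‖ + 1 := by simpa using (Metric.mem_ball.1 hx).le
      exact mul_le_mul (cf_norm_le A n) this (norm_nonneg _) (by positivity))
    (fun n => by fun_prop)
  have h2 := h.differentiableOn
    (.of_forall fun _ ↦ by simpa [Finset.prod_fn] using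
      DifferentiableOn.finsetProd (fun _ _ ↦ by fun_prop)) Metric.isOpen_ball
  exact h2.differentiableAt (Metric.isOpen_ball.mem_nhds (by simp))

lemma PA_ne_zero (A : Set ℕ) (z : ℂ) (hz : ∀ n ∈ A, z ≠ 2^n) : PA A z ≠ 0 := by
  refine tprod_one_add_ne_zero_of_summable (fun n => ?_) (cf_summable A z)
  unfold cf
  split_ifs with h
  · intro h2
    apply hz n h
    have h3 : ((2:ℂ)^n) ≠ 0 := pow_ne_zero _ two_ne_zero
    have h4 : ((1/2:ℂ)^n) * z = 1 := by linear_combination -h2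
    rw [one_div, inv_pow] at h4
    field_simp at h4
    exact h4
  · simp

lemma PA_split (A : Set ℕ) (n : ℕ) (hn : n ∈ A) (z : ℂ) :
    PA A z = (1 - (1/2)^n * z) * PA (A \ {n}) z := by
  have hh : ∀ x, (if x = n then 1 else 1 + cf A x * z) = 1 + cf (A \ {n}) x * z := by
    intro x
    by_cases hx : x = n
    · simp [cf, hx]
    · by_cases hxA : x ∈ A
      · have h1 : x ∈ A \ {n} := ⟨hxA, hx⟩
        simp only [cf, if_neg hx, if_pos hxA, if_pos h1]
      · have h1 : x ∉ A \ {n} := fun h => hxA h.1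
        simp only [cf, if_neg hx, if_neg hxA, if_neg h1]
  have hu : Function.update (fun x => 1 + cf A x * z) n 1 = fun x => 1 + cf (A \ {n}) x * z := by
    ext x
    rw [← hh x, Function.update_apply]
  unfold PA
  rw [Multipliable.tprod_eq_mul_tprod_ite' n
    (by rw [hu]; exact multipliable_one_add_of_summable (cf_summable _ z))]
  simp only [hh]
  congr 1
  simp [cf, hn]
  ring

def FA (A : Set ℕ) : HoloMaps :=
  ⟨⟨fun z => ⟨PA A z, PA_ne_zero A z (fun n _ => by
      have := z.2 (2^n); push_cast at this; exact this)⟩,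
    ((PA_diff A).continuous.comp continuous_subtype_val).subtype_mk _⟩, by
    have h : ContMDiff 𝓘(ℂ, ℂ) 𝓘(ℂ, ℂ) (⊤ : ℕ∞) (PA A) := (PA_diff A).contDiff.contMDiff
    have h2 : ContMDiff 𝓘(ℂ, ℂ) 𝓘(ℂ, ℂ) (⊤ : ℕ∞) (PA A ∘ (Subtype.val : planeMinusIntegers → ℂ)) :=
      h.comp contMDiff_subtype_val
    refine ContMDiff.mdifferentiable (n := (⊤ : ℕ∞)) ?_ (by simp)
    rw [← ContMDiff.subtypeVal_comp_iff]
    exact h2⟩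

/-- the loop of radius r about the integer c -/
def loopAt (c : ℤ) (r : ℝ) (h0 : 0 < r) (h1 : r < 1) : C(Circle, planeMinusIntegers) :=
  ⟨fun w => ⟨c + r * w, fun m hm => by
    have h2 : (r : ℂ) * w = ((m - c : ℤ) : ℂ) := by push_cast; linear_combination hm
    have h3 : r = ((|m - c| : ℤ) : ℝ) := by
      have := congrArg norm h2
      rw [norm_mul, Circle.norm_coe, Complex.norm_intCast, Complex.norm_real,
        Real.norm_of_nonneg h0.le, mul_one] at this
      rw [this]; push_cast; rfl
    rw [h3] at h0 h1
    have h4 : 0 < |m - c| := by exact_mod_cast h0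
    have h5 : |m - c| < 1 := by exact_mod_cast h1
    omega⟩, by
    refine Continuous.subtype_mk ?_ _
    fun_prop⟩

def valMap : C(puncturedPlane, ℂ) := ⟨Subtype.val, continuous_subtype_val⟩

def restr (γ : C(Circle, planeMinusIntegers)) (f : HoloMaps) : C(Circle, ℂ) :=
  valMap.comp (f.1.comp γ)

lemma restr_ne (γ : C(Circle, planeMinusIntegers)) (f : HoloMaps) (w : Circle) :
    restr γ f w ≠ 0 := (f.1 (γ w)).2

lemma restr_cont (γ : C(Circle, planeMinusIntegers)) : Continuous (restr γ) :=
  (ContinuousMap.continuous_postcomp valMap).comp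
    ((ContinuousMap.continuous_precomp γ).comp continuous_subtype_val)

def LRel (γ : C(Circle, planeMinusIntegers)) (f g : HoloMaps) : Prop :=
  ∃ L : C(Circle, ℂ), ∀ w, restr γ g w = restr γ f w * Complex.exp (L w)

lemma LRel.refl (γ) (f : HoloMaps) : LRel γ f f := ⟨0, by simp⟩

lemma LRel.symm {γ} {f g : HoloMaps} (h : LRel γ f g) : LRel γ g f := by
  obtain ⟨L, hL⟩ := h
  refine ⟨-L, fun w => ?_⟩
  rw [hL, mul_assoc, ← Complex.exp_add]
  simp

lemma LRel.trans {γ} {f g k : HoloMaps} (h : LRel γ f g) (h' : LRel γ g k) : LRel γ f k := by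
  obtain ⟨L, hL⟩ := h
  obtain ⟨M, hM⟩ := h'
  refine ⟨L + M, fun w => ?_⟩
  rw [hM, hL, mul_assoc, ← Complex.exp_add]
  simp

/-- a map to `ℂ` close to `1` has a logarithm -/
lemma exists_log (u : C(Circle, ℂ)) (hu : ∀ w, ‖u w - 1‖ < 1) :
    ∃ L : C(Circle, ℂ), ∀ w, u w = Complex.exp (L w) := by
  have hs : ∀ w, u w ∈ Complex.slitPlane := fun w => by
    have := Complex.mem_slitPlane_of_norm_lt_one (hu w)
    simpa using this
  exact ⟨⟨fun w => Complex.log (u w), u.continuous.clog hs⟩, fun w =>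
    (Complex.exp_log (Complex.slitPlane_ne_zero (hs w))).symm⟩

lemma LRel_nhds (γ) (f : HoloMaps) : {g | LRel γ f g} ∈ nhds f := by
  let inv : C(Circle, ℂ) := ⟨fun w => (restr γ f w)⁻¹,
    (restr γ f).continuous.inv₀ (restr_ne γ f)⟩
  have hc : Continuous fun g => ‖restr γ g * inv - 1‖ :=
    (((restr_cont γ).mul continuous_const).sub continuous_const).norm
  have h0 : ‖restr γ f * inv - 1‖ < 1 := by
    have : restr γ f * inv = 1 := by
      ext w
      simp [inv, restr_ne γ f w]
    rw [this]; simp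
  filter_upwards [(isOpen_Iio.preimage hc).mem_nhds h0] with g hg
  obtain ⟨L, hL⟩ := exists_log (restr γ g * inv) (fun w =>
    ((restr γ g * inv - 1).norm_coe_le_norm w).trans_lt hg)
  refine ⟨L, fun w => ?_⟩
  rw [← hL w]
  have := restr_ne γ f w
  simp only [inv, ContinuousMap.mul_apply, ContinuousMap.coe_mk]
  field_simp

lemma LRel_of_joined (γ) {f g : HoloMaps} (h : Joined f g) : LRel γ f g := by
  have ho : ∀ f, IsOpen {g | LRel γ f g} := fun f => isOpen_iff_mem_nhds.2 fun g hg =>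
    Filter.mem_of_superset (LRel_nhds γ g) fun k hk => LRel.trans hg hk
  have hcl : IsClopen {g | LRel γ f g} := by
    refine ⟨⟨isOpen_iff_mem_nhds.2 fun g hg => ?_⟩, ho f⟩
    exact Filter.mem_of_superset (LRel_nhds γ g) fun k hk hk' => hg (hk'.trans hk.symm)
  obtain ⟨p⟩ := h
  have hp : IsClopen (p ⁻¹' {g | LRel γ f g}) := hcl.preimage p.continuous
  have h1 := hp.eq_univ ⟨0, by simpa using LRel.refl γ f⟩
  have : (1 : unitInterval) ∈ p ⁻¹' {g | LRel γ f g} := h1 ▸ Set.mem_univ _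
  simpa using this

lemma no_log (L : C(Circle, ℂ)) (hL : ∀ w : Circle, (w : ℂ) = Complex.exp (L w)) : False := by
  let g : ℝ → ℝ := fun θ => (L (Circle.exp θ)).im - θ
  have hg : Continuous g := by
    have : Continuous fun θ : ℝ => L (Circle.exp θ) := L.continuous.comp Circle.exp.continuous
    exact (Complex.continuous_im.comp this).sub continuous_id
  have hint : ∀ θ, ∃ k : ℤ, g θ = k * (2 * Real.pi) := by
    intro θ
    have h := hL (Circle.exp θ)
    rw [Circle.coe_exp, Complex.exp_eq_exp_iff_exists_int] at h
    obtain ⟨k, hk⟩ := h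
    refine ⟨-k, ?_⟩
    have := congrArg Complex.im hk
    simp at this
    simp only [g]
    push_cast
    linarith
  have hper : g (2 * Real.pi) = g 0 - 2 * Real.pi := by
    simp [g]
  have hpi := Real.pi_pos
  obtain ⟨t, -, ht⟩ := intermediate_value_Icc' (a := 0) (b := 2 * Real.pi) (by positivity)
    hg.continuousOn (show g 0 - Real.pi ∈ Set.Icc (g (2 * Real.pi)) (g 0) by
      rw [hper]; constructor <;> linarith)
  obtain ⟨k, hk⟩ := hint t
  obtain ⟨m, hm⟩ := hint 0
  rw [hk, hm] at ht
  have h2 : (2 * k : ℝ) = 2 * m - 1 := by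
    apply mul_right_cancel₀ hpi.ne'
    linarith
  have h3 : 2 * k = 2 * m - 1 := by exact_mod_cast h2
  omega

lemma not_joined {A B : Set ℕ} {n : ℕ} (hA : n ∈ A) (hB : n ∉ B) :
    ¬ Joined (FA B) (FA A) := by
  intro hj
  let c : ℂ := 2^n
  have hcne : c ≠ 0 := by simp [c]
  have h2 : ∀ {m : ℕ}, (2:ℂ)^n = 2^m → n = m := by
    intro m h
    have : (2:ℕ)^n = 2^m := by exact_mod_cast h
    exact Nat.pow_right_injective le_rfl this
  have hp : PA (A \ {n}) c ≠ 0 := PA_ne_zero _ _ fun m hm h => hm.2 (h2 h).symm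
  have hq : PA B c ≠ 0 := PA_ne_zero _ _ fun m hm h => hB (h2 h ▸ hm)
  let v : ℂ → ℂ := fun z => PA (A \ {n}) z / PA B z
  let u : ℂ → ℂ := fun z => v z / v c
  have hvc : v c ≠ 0 := div_ne_zero hp hq
  have hu : ContinuousAt u c :=
    ((PA_diff _).continuous.continuousAt.div (PA_diff B).continuous.continuousAt hq).div_const _
  have huc : u c = 1 := div_self hvc
  obtain ⟨δ, hδ, hδu⟩ := Metric.continuousAt_iff.1 hu 1 one_pos
  let r : ℝ := min (δ/2) (1/2)
  have hr0 : 0 < r := by positivity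
  have hr1 : r < 1 := (min_le_right _ _).trans_lt (by norm_num)
  have hrδ : r < δ := (min_le_left _ _).trans_lt (by linarith)
  let γ := loopAt (2^n) r hr0 hr1
  have hγ : ∀ w, ((γ w : planeMinusIntegers) : ℂ) = c + r * w := fun w => by
    simp [γ, loopAt, c]
  obtain ⟨L, hL⟩ := LRel_of_joined γ hj
  have hBne : ∀ w : Circle, PA B (c + r * w) ≠ 0 := fun w => by
    rw [← hγ]; exact restr_ne γ (FA B) w
  have hucont : Continuous fun w : Circle => u (c + r * w) := by
    have h1 : Continuous fun w : Circle => c + r * (w : ℂ) := by fun_prop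
    exact (((PA_diff (A \ {n})).continuous.comp h1).div
      ((PA_diff B).continuous.comp h1) hBne).div_const _
  obtain ⟨M, hM⟩ := exists_log ⟨_, hucont⟩ (fun w => by
    have := hδu (x := c + r * (w : Circle)) (by
      rw [dist_eq_norm, add_sub_cancel_left, norm_mul, Circle.norm_coe, Complex.norm_real,
        Real.norm_of_nonneg hr0.le, mul_one]
      exact hrδ)
    rw [huc, dist_eq_norm] at this
    exact this)
  -- constant
  let κ : ℂ := - (r / c) * v c
  have hκ : κ ≠ 0 := mul_ne_zero (neg_ne_zero.2 (div_ne_zero (by exact_mod_cast hr0.ne') hcne)) hvc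
  refine no_log (L - M - ContinuousMap.const _ (Complex.log κ)) fun w => ?_
  have e1 : PA A (c + r * w) = PA B (c + r * w) * Complex.exp (L w) := by
    rw [← hγ]; exact hL w
  have e2 : PA (A \ {n}) (c + r * w) = Complex.exp (M w) * v c * PA B (c + r * w) := by
    rw [← hM w]
    have := hBne w
    change _ = v (c + r * w) / v c * v c * _
    rw [div_mul_cancel₀ _ hvc]
    exact (div_mul_cancel₀ _ this).symm
  rw [PA_split A n hA, e2] at e1
  have e3 : (1 - (1/2)^n * (c + r * w)) = -(r / c) * w := by
    have : (1/2 : ℂ)^n = c⁻¹ := by simp [c]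
    rw [this]; field_simp; ring
  rw [e3] at e1
  have e4 : Complex.exp (L w) = κ * w * Complex.exp (M w) := by
    apply mul_left_cancel₀ (hBne w)
    rw [← e1]; simp only [κ]; ring
  simp only [ContinuousMap.sub_apply, ContinuousMap.const_apply, Complex.exp_sub,
    Complex.exp_log hκ, e4]
  have := Complex.exp_ne_zero (M w)
  field_simp

/-- the space `O(X, S)` of holomorphic maps from `X = ℂ ∖ ℤ` to the
punctured plane `S = ℂ ∖ {0}`, with the compact-open topology, has uncountably many
path components. -/
theorem stmt_0 : ¬ Countable (ZerothHomotopy HoloMaps) := by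
  intro hc
  have hinj : Function.Injective
      (fun A : Set ℕ => (Quotient.mk (pathSetoid HoloMaps) (FA A) : ZerothHomotopy HoloMaps)) := by
    intro A B h
    have hj : Joined (FA A) (FA B) := Quotient.exact h
    ext n
    constructor
    · intro hA
      by_contra hB
      exact not_joined hA hB hj.symm
    · intro hB
      by_contra hA
      exact not_joined hB hA hj
  have : Countable (Set ℕ) := @Function.Injective.countable _ _ hc _ hinj
  obtain ⟨f, hf⟩ := exists_injective_nat (Set ℕ)
  exact Function.cantor_injective f hf
end
end

section
/- In the space A = O(X,S) of holomorphic maps from X = ℂ \ ℤ to S = ℂ \ {0} with the compact-open topology, every nonempty open subset meets uncountably many path components of A; consequently no nonempty open subset of A is contractible within A. -/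
noncomputable section
open scoped Manifold
open TopologicalSpace

/-- `f` has a continuous logarithm on the circle. -/
def HasLog (f : Circle → ℂ) : Prop := ∃ φ : Circle → ℂ, Continuous φ ∧ ∀ w, Complex.exp (φ w) = f w

lemma HasLog.div {f g : Circle → ℂ} (hf : HasLog f) (hg : HasLog g) :
    HasLog (fun w => f w / g w) := by
  obtain ⟨φ, h1, h2⟩ := hf
  obtain ⟨ψ, h3, h4⟩ := hg
  exact ⟨fun w => φ w - ψ w, h1.sub h3, fun w => by rw [Complex.exp_sub, h2, h4]⟩

lemma hasLog_const {c : ℂ} (hc : c ≠ 0) : HasLog (fun _ => c) :=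
  ⟨fun _ => Complex.log c, continuous_const, fun _ => Complex.exp_log hc⟩

lemma hasLog_of_homotopy (G : unitInterval → Circle → ℂ)
    (hG : Continuous (fun p : unitInterval × Circle => G p.1 p.2))
    (h0 : ∀ t w, G t w ≠ 0) (hl : HasLog (G 0)) : HasLog (G 1) := by
  obtain ⟨φ, h1, h2⟩ := hl
  let H : C(unitInterval × Circle, {z : ℂ // z ≠ 0}) :=
    ⟨fun p => ⟨G p.1 p.2, h0 _ _⟩, by fun_prop⟩
  have H_0 : ∀ a, H (0, a) = (fun z : ℂ ↦ (⟨_, z.exp_ne_zero⟩ : {z : ℂ // z ≠ 0}))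
    ((⟨φ, h1⟩ : C(Circle, ℂ)) a) := fun a => Subtype.ext (h2 a).symm
  have key := Complex.isCoveringMap_exp.liftHomotopy_lifts H ⟨φ, h1⟩ H_0
  refine ⟨fun w => Complex.isCoveringMap_exp.liftHomotopy H ⟨φ, h1⟩ H_0 (1, w), by fun_prop, ?_⟩
  intro w
  exact congrArg Subtype.val (congrFun key (1, w))

lemma not_hasLog_coe : ¬ HasLog (fun w => (w : ℂ)) := by
  rintro ⟨φ, hc, h⟩
  let ψ : ℝ → ℂ := fun t => (φ (Circle.exp t) - t * Complex.I) / (2 * Real.pi * Complex.I)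
  have hψ : Continuous ψ := by
    have := Circle.exp.continuous
    fun_prop
  have hint : ∀ t, ∃ n : ℤ, ψ t = n := by
    intro t
    have h1 : Complex.exp (φ (Circle.exp t)) = (Circle.exp t : ℂ) := h (Circle.exp t)
    rw [Circle.coe_exp, Complex.exp_eq_exp_iff_exists_int] at h1
    obtain ⟨n, hn⟩ := h1
    refine ⟨n, ?_⟩
    have : (2 * Real.pi * Complex.I : ℂ) ≠ 0 := Complex.two_pi_I_ne_zero
    simp only [ψ]
    rw [hn]
    field_simp
    ring
  choose n hn using hint
  have hnc : Continuous n := by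
    have : Continuous (fun t => ((n t : ℤ) : ℝ)) := by
      have h2 : (fun t => ((n t : ℤ) : ℝ)) = fun t => (ψ t).re := by
        ext t; rw [hn]; simp
      rw [h2]; fun_prop
    exact Int.isClosedEmbedding_coe_real.isEmbedding.continuous_iff.mpr this
  have h3 : n 0 = n (2 * Real.pi) := by
    exact PreconnectedSpace.constant inferInstance hnc
  have h4 : ψ 0 = ψ (2 * Real.pi) := by rw [hn, hn, h3]
  have : (2 * Real.pi * Complex.I : ℂ) ≠ 0 := Complex.two_pi_I_ne_zero
  simp only [ψ, Circle.exp_two_pi, Circle.exp_zero] at h4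
  rw [div_left_inj' this] at h4
  apply this
  push_cast at h4
  linear_combination h4

/-- The `j`-th pole. -/
def pole (j : ℕ) : ℂ := 2 ^ (j + 1)

def polTerm (d : ℕ → Bool) (j : ℕ) (z : ℂ) : ℂ := if d j then 1 / (z - pole j) else 0

def prodF (d : ℕ → Bool) (z : ℂ) : ℂ := ∏' j, (1 + polTerm d j z)

lemma term_bound (R : ℝ) : ∀ᶠ j in Filter.atTop, ∀ (d : ℕ → Bool) (z : ℂ), ‖z‖ ≤ R →
    ‖polTerm d j z‖ ≤ (1 / 2 : ℝ) ^ j := by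
  have h := tendsto_pow_atTop_atTop_of_one_lt (r := (2 : ℝ)) (by norm_num)
  filter_upwards [h.eventually_ge_atTop R] with j hj d z hz
  unfold polTerm
  split_ifs
  · have h1 : (2 : ℝ) ^ j ≤ ‖z - pole j‖ := by
      have h2 : ‖pole j‖ = 2 ^ (j + 1) := by simp [pole]
      have h3 := norm_sub_norm_le (pole j) z
      rw [norm_sub_rev, h2, pow_succ] at h3
      linarith
    rw [norm_div, norm_one, div_pow, one_pow]
    exact one_div_le_one_div_of_le (by positivity) h1
  · simp

lemma summable_half : Summable (fun j : ℕ => (1 / 2 : ℝ) ^ j) :=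
  summable_geometric_of_lt_one (by norm_num) (by norm_num)

lemma term_summable (d : ℕ → Bool) (z : ℂ) : Summable (fun j => ‖polTerm d j z‖) := by
  apply Summable.of_norm_bounded_eventually_nat summable_half
  filter_upwards [term_bound ‖z‖] with j hj
  simpa using hj d z le_rfl

lemma hasProd_lu {α : Type*} [TopologicalSpace α] [LocallyCompactSpace α] (K : Set α)
    (hK : IsOpen K) (D : α → ℕ → Bool) (Z : α → ℂ) (R : ℝ) (hR : ∀ x ∈ K, ‖Z x‖ ≤ R)
    (hc : ∀ j, ContinuousOn (fun x => polTerm (D x) j (Z x)) K) :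
    HasProdLocallyUniformlyOn (fun j x => 1 + polTerm (D x) j (Z x)) (fun x => prodF (D x) (Z x)) K := by
  apply Summable.hasProdLocallyUniformlyOn_nat_one_add hK summable_half _ hc
  filter_upwards [term_bound R] with j hj x hx
  exact hj _ _ (hR x hx)

lemma prodF_continuousOn {α : Type*} [TopologicalSpace α] [LocallyCompactSpace α] (K : Set α)
    (hK : IsOpen K) (D : α → ℕ → Bool) (Z : α → ℂ) (R : ℝ) (hR : ∀ x ∈ K, ‖Z x‖ ≤ R)
    (hc : ∀ j, ContinuousOn (fun x => polTerm (D x) j (Z x)) K) :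
    ContinuousOn (fun x => prodF (D x) (Z x)) K := by
  have h := hasProd_lu K hK D Z R hR hc
  rw [hasProdLocallyUniformlyOn_iff_tendstoLocallyUniformlyOn] at h
  refine h.continuousOn (Filter.Eventually.of_forall fun s => ?_).frequently
  exact continuousOn_finsetProd _ fun i _ => continuousOn_const.add (hc i)

lemma pole_int (j : ℕ) : pole j = ((2 ^ (j + 1) : ℤ) : ℂ) := by simp [pole]

lemma prodF_ne_zero (d : ℕ → Bool) (z : ℂ) (h : ∀ j, d j = true → z ≠ pole j → z ≠ pole j - 1) :
    prodF d z ≠ 0 := by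
  apply tprod_one_add_ne_zero_of_summable _ (term_summable d z)
  intro j
  unfold polTerm
  split_ifs with hd
  · by_cases hz : z = pole j
    · simp [hz]
    have h1 := h j hd hz
    have h2 : z - pole j ≠ 0 := sub_ne_zero.mpr hz
    intro h3
    field_simp at h3
    apply h1
    linear_combination h3
  · simp

lemma prodF_split (d : ℕ → Bool) (k : ℕ) (z : ℂ) :
    prodF d z = (1 + polTerm d k z) * prodF (Function.update d k false) z := by
  have h : (fun j => 1 + polTerm (Function.update d k false) j z) =
      Function.update (fun j => 1 + polTerm d j z) k 1 := by
    ext j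
    by_cases hj : j = k
    · subst hj; simp [polTerm]
    · simp [polTerm, hj]
  have hm : Multipliable (Function.update (fun j => 1 + polTerm d j z) k 1) := by
    rw [← h]
    exact multipliable_one_add_of_summable (term_summable _ z)
  unfold prodF
  rw [Multipliable.tprod_eq_mul_tprod_ite' k hm, h]
  congr 1
  refine tprod_congr fun j => ?_
  simp [Function.update_apply]

lemma mem_X {z : ℂ} : z ∈ planeMinusIntegers ↔ ∀ n : ℤ, z ≠ n := Iff.rfl

lemma prodF_ne_zero_X (d : ℕ → Bool) {z : ℂ} (h : z ∈ planeMinusIntegers) : prodF d z ≠ 0 := by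
  apply prodF_ne_zero
  intro j _ _ h2
  apply h (2 ^ (j + 1) - 1)
  rw [h2, pole_int]; push_cast; ring

lemma sub_pole_ne {z : ℂ} (h : z ∈ planeMinusIntegers) (j : ℕ) : z - pole j ≠ 0 := by
  rw [pole_int]; exact sub_ne_zero.mpr (h _)

lemma prodF_cont : Continuous (fun p : (ℕ → Bool) × planeMinusIntegers => prodF p.1 p.2) := by
  have : LocallyCompactSpace planeMinusIntegers := planeMinusIntegers.isOpen.locallyCompactSpace
  rw [continuous_iff_continuousAt]
  intro p
  let K : Set ((ℕ → Bool) × planeMinusIntegers) := {q | ‖(q.2 : ℂ)‖ < ‖(p.2 : ℂ)‖ + 1}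
  have hK : IsOpen K := isOpen_lt (by fun_prop) (by fun_prop)
  refine (prodF_continuousOn K hK (fun q => q.1) (fun q => q.2) (‖(p.2 : ℂ)‖ + 1)
    (fun q hq => le_of_lt hq) ?_).continuousAt (hK.mem_nhds (by simp [K]))
  intro j
  apply Continuous.continuousOn
  have h1 : (fun x : (ℕ → Bool) × planeMinusIntegers => polTerm x.1 j x.2) =
    fun x => (fun b : Bool => if b then (1 : ℂ) else 0) (x.1 j) * (1 / ((x.2 : ℂ) - pole j)) := by
    ext x; simp [polTerm]
  rw [h1]
  refine Continuous.mul ((continuous_of_discreteTopology (f := fun b : Bool => if b then (1 : ℂ) else 0)).comp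
    ((continuous_apply j).comp continuous_fst)) ?_
  exact continuous_const.div (by fun_prop) (fun x => sub_pole_ne x.2.2 j)

lemma prodF_diff (d : ℕ → Bool) : DifferentiableOn ℂ (prodF d) planeMinusIntegers := by
  intro z hz
  apply DifferentiableAt.differentiableWithinAt
  let K : Set ℂ := planeMinusIntegers ∩ Metric.ball 0 (‖z‖ + 1)
  have hK : IsOpen K := planeMinusIntegers.isOpen.inter Metric.isOpen_ball
  have hd : ∀ j, DifferentiableOn ℂ (polTerm d j) K := by
    intro j
    by_cases h : d j = true
    · have : polTerm d j = fun z => 1 / (z - pole j) := by ext z; simp [polTerm, h]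
      rw [this]
      exact (differentiableOn_const _).div (by fun_prop) (fun x hx => sub_pole_ne hx.1 j)
    · have : polTerm d j = fun z => 0 := by ext z; simp [polTerm, h]
      rw [this]; fun_prop
  have h := hasProd_lu K hK (fun _ => d) (fun z => z) (‖z‖ + 1)
    (fun x hx => by simpa using (Metric.mem_ball.mp hx.2).le) (fun j => (hd j).continuousOn)
  rw [hasProdLocallyUniformlyOn_iff_tendstoLocallyUniformlyOn] at h
  refine (h.differentiableOn (Filter.Eventually.of_forall fun s => ?_) hK).differentiableAt
    (hK.mem_nhds ⟨hz, by simp⟩)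
  exact DifferentiableOn.fun_finsetProd fun i _ => (hd i).const_add 1

lemma int_norm {m : ℤ} (h : ‖(m : ℂ)‖ < 1) : m = 0 := by
  rw [Complex.norm_intCast] at h
  exact_mod_cast Int.abs_lt_one_iff.mp (by exact_mod_cast h)

/-- The product is zero-free and continuous near the `k`-th pole if `d k = false`. -/
lemma prodF_ball_cont (d : ℕ → Bool) (k : ℕ) (hk : d k = false) :
    ContinuousOn (prodF d) (Metric.ball (pole k) 1) := by
  refine prodF_continuousOn (Metric.ball (pole k) 1) Metric.isOpen_ball (fun _ => d) (fun z => z)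
    (‖pole k‖ + 1) ?_ ?_
  · intro x hx
    have := Metric.mem_ball.mp hx
    rw [dist_eq_norm] at this
    have h2 := norm_sub_norm_le x (pole k)
    linarith
  · intro j
    by_cases h : d j = true
    · have : (fun x => polTerm d j x) = fun z => 1 / (z - pole j) := by ext z; simp [polTerm, h]
      rw [this]
      refine continuousOn_const.div (by fun_prop) ?_
      intro x hx h0
      rw [sub_eq_zero] at h0
      subst h0
      rw [Metric.mem_ball, dist_eq_norm, pole_int, pole_int, ← Int.cast_sub] at hx
      have h3 : (2 : ℤ) ^ (j + 1) = 2 ^ (k + 1) := sub_eq_zero.mp (int_norm hx)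
      have h4 : j + 1 = k + 1 := Int.pow_right_injective (le_refl 2) h3
      have h5 : j = k := by omega
      subst h5
      simp [hk] at h
    · have : (fun x => polTerm d j x) = fun z => 0 := by ext z; simp [polTerm, h]
      rw [this]; fun_prop

lemma prodF_ball_ne (d : ℕ → Bool) (k : ℕ) (z : ℂ) (hz : z ∈ Metric.ball (pole k) 1) :
    prodF d z ≠ 0 := by
  apply prodF_ne_zero
  rintro j hj - rfl
  rw [Metric.mem_ball, dist_eq_norm, pole_int, pole_int] at hz
  have h1 := int_norm (m := 2 ^ (j + 1) - 1 - 2 ^ (k + 1)) (by push_cast at hz ⊢; exact hz)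
  rw [pow_succ, pow_succ] at h1
  omega

lemma mdiff_iff (f : planeMinusIntegers → puncturedPlane) (g : ℂ → ℂ)
    (h : ∀ z : planeMinusIntegers, (f z : ℂ) = g z) :
    MDifferentiable 𝓘(ℂ, ℂ) 𝓘(ℂ, ℂ) f ↔ DifferentiableOn ℂ g planeMinusIntegers := by
  have h2 : Subtype.val ∘ f = fun z : planeMinusIntegers => g z := by ext z; exact h z
  have : ∀ z : planeMinusIntegers, MDifferentiableAt 𝓘(ℂ, ℂ) 𝓘(ℂ, ℂ) f z ↔ DifferentiableAt ℂ g z := by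
    intro z
    rw [← mdifferentiableAt_iff_differentiableAt]
    have e1 := (differentiableWithinAt_localInvariantProp (I := 𝓘(ℂ, ℂ)) (I' := 𝓘(ℂ, ℂ))).liftPropAt_iff_comp_subtype_val g z
    have e2 := ChartedSpace.liftPropWithinAt_subtypeVal_comp_iff (P := DifferentiableWithinAtProp 𝓘(ℂ, ℂ) 𝓘(ℂ, ℂ)) f Set.univ z
    rw [h2] at e2
    exact e2.symm.trans e1.symm
  constructor
  · intro hm z hz
    exact ((this ⟨z, hz⟩).mp (hm _)).differentiableWithinAt
  · intro hm z
    exact (this z).mpr ((hm z z.2).differentiableAt (planeMinusIntegers.isOpen.mem_nhds z.2))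

/-- The perturbed map. -/
def pert (f : HoloMaps) (d : ℕ → Bool) : HoloMaps :=
  ⟨⟨fun z => ⟨(f.1 z : ℂ) * prodF d z, mul_ne_zero (f.1 z).2 (prodF_ne_zero_X d z.2)⟩, by
    have h1 : Continuous (fun z : planeMinusIntegers => prodF d z) :=
      prodF_cont.comp (by fun_prop : Continuous fun z : planeMinusIntegers => (d, z))
    have h2 : Continuous (fun z => (f.1 z : ℂ)) := continuous_subtype_val.comp f.1.continuous
    exact (h2.mul h1).subtype_mk _⟩, by
    let g : ℂ → ℂ := fun z => open Classical in
      if h : z ∈ planeMinusIntegers then (f.1 ⟨z, h⟩ : ℂ) else 0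
    have hg : ∀ z : planeMinusIntegers, (f.1 z : ℂ) = g z := fun z => by
      simp [g]
    have h1 := (mdiff_iff f.1 g hg).mp f.2
    refine (mdiff_iff _ (fun z => g z * prodF d z) ?_).mpr (h1.mul (prodF_diff d))
    intro z
    simp [hg]⟩

lemma pert_apply (f : HoloMaps) (d : ℕ → Bool) (z : planeMinusIntegers) :
    ((pert f d).1 z : ℂ) = (f.1 z : ℂ) * prodF d z := rfl

lemma pert_cont (f : HoloMaps) : Continuous (pert f) := by
  refine Continuous.subtype_mk (f := fun d => (pert f d).1) ?_ (fun d => (pert f d).2)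
  apply ContinuousMap.continuous_of_continuous_uncurry
  have h2 : Continuous (fun p : (ℕ → Bool) × planeMinusIntegers => (f.1 p.2 : ℂ)) :=
    continuous_subtype_val.comp (f.1.continuous.comp continuous_snd)
  exact (h2.mul prodF_cont).subtype_mk _

lemma pert_zero (f : HoloMaps) : pert f (fun _ => false) = f := by
  apply Subtype.ext
  ext z
  rw [pert_apply]
  simp [prodF, polTerm]

lemma circ_mem (k : ℕ) (w : Circle) : pole k + w / 2 ∈ planeMinusIntegers := by
  intro n hn
  have h1 : ((n - 2 ^ (k + 1) : ℤ) : ℂ) = w / 2 := by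
    rw [Int.cast_sub, ← hn, pole_int]; ring
  have h2 : ‖((n - 2 ^ (k + 1) : ℤ) : ℂ)‖ = 1 / 2 := by
    rw [h1, norm_div, Circle.norm_coe]; simp
  have h3 := int_norm (by rw [h2]; norm_num)
  rw [h3] at h2
  norm_num at h2

lemma ball_mem (k : ℕ) (t : unitInterval) (w : Circle) :
    pole k + t * w / 2 ∈ Metric.ball (pole k) 1 := by
  have h1 := t.2.1
  have h2 := t.2.2
  simp only [Metric.mem_ball, dist_eq_norm, add_sub_cancel_left]
  rw [norm_div, norm_mul, Circle.norm_coe, Complex.norm_real, Real.norm_of_nonneg h1]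
  norm_num
  linarith

lemma not_joined_s1 (f : HoloMaps) (d e : ℕ → Bool) (k : ℕ) (hd : d k = true) (he : e k = false) :
    ¬ Joined (pert f e) (pert f d) := by
  rintro ⟨γ⟩
  have : LocallyCompactSpace planeMinusIntegers := planeMinusIntegers.isOpen.locallyCompactSpace
  let P : Circle → planeMinusIntegers := fun w => ⟨pole k + w / 2, circ_mem k w⟩
  have hP : Continuous P := by
    refine Continuous.subtype_mk ?_ _
    fun_prop
  -- first homotopy
  have hγ : Continuous (fun t => (γ t).1) := continuous_subtype_val.comp γ.continuous
  have hev : Continuous (fun p : unitInterval × Circle => (((γ p.1).1 (P p.2) : puncturedPlane) : ℂ)) :=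
    continuous_subtype_val.comp
      (Continuous.eval (hγ.comp continuous_fst) (hP.comp continuous_snd))
  have hbase : Continuous (fun p : unitInterval × Circle => (((pert f e).1 (P p.2) : puncturedPlane) : ℂ)) :=
    continuous_subtype_val.comp ((pert f e).1.continuous.comp (hP.comp continuous_snd))
  have L1 := hasLog_of_homotopy
    (fun t w => (((γ t).1 (P w) : puncturedPlane) : ℂ) / (((pert f e).1 (P w) : puncturedPlane) : ℂ))
    (hev.div hbase fun p => ((pert f e).1 (P p.2)).2)
    (fun t w => div_ne_zero ((γ t).1 (P w)).2 ((pert f e).1 (P w)).2)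
    (by
      have : (fun w => (((γ 0).1 (P w) : puncturedPlane) : ℂ) /
          (((pert f e).1 (P w) : puncturedPlane) : ℂ)) = fun _ => 1 := by
        ext w
        rw [γ.source]
        exact div_self ((pert f e).1 (P w)).2
      exact this ▸ hasLog_const one_ne_zero)
  rw [γ.target] at L1
  -- second homotopy
  let d' := Function.update d k false
  let u : ℂ → ℂ := fun z => (z - pole k + 1) * prodF d' z / prodF e z * 2
  have hu : ContinuousOn u (Metric.ball (pole k) 1) := by
    have c1 := prodF_ball_cont d' k (by simp [d'])
    have c2 := prodF_ball_cont e k he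
    refine ContinuousOn.mul (ContinuousOn.div (ContinuousOn.mul (by fun_prop) c1) c2 ?_)
      continuousOn_const
    exact fun z hz => prodF_ball_ne e k z hz
  have hu0 : ∀ z ∈ Metric.ball (pole k) 1, u z ≠ 0 := by
    intro z hz
    refine mul_ne_zero (div_ne_zero (mul_ne_zero ?_ (prodF_ball_ne _ k z hz))
      (prodF_ball_ne _ k z hz)) two_ne_zero
    intro h
    have : z - pole k = -1 := by linear_combination h
    rw [Metric.mem_ball, dist_eq_norm, this] at hz
    simp at hz
  have L2 := hasLog_of_homotopy (fun t w => u (pole k + t * w / 2))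
    (hu.comp_continuous (by fun_prop) (fun p => ball_mem k p.1 p.2))
    (fun t w => hu0 _ (ball_mem k t w))
    (by
      have : (fun w : Circle => u (pole k + ((0 : unitInterval) : ℝ) * w / 2)) =
          fun _ => u (pole k) := by ext w; simp
      exact this ▸ hasLog_const (hu0 _ (by simp)))
  have L3 := L2.div L1
  apply not_hasLog_coe
  convert L3 using 2 with w
  rw [pert_apply, pert_apply, prodF_split d k]
  have hf := (f.1 (P w)).2
  have hw : (w : ℂ) ≠ 0 := w.coe_ne_zero
  have hz : ((P w : planeMinusIntegers) : ℂ) = pole k + w / 2 := rfl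
  have n1 := prodF_ne_zero_X d' (P w).2
  have n2 := prodF_ne_zero_X e (P w).2
  have hf' : (f.1 (P w) : ℂ) ≠ 0 := hf
  have n3 : (w : ℂ) / 2 + 1 ≠ 0 := by
    have := hu0 _ (ball_mem k 1 w)
    intro h0
    apply this
    simp [u, h0]
  have n4 : (w : ℂ) + 2 ≠ 0 := by
    intro h0; apply n3; linear_combination h0 / 2
  have hone : (((1 : unitInterval) : ℝ) : ℂ) * w = w := by simp
  have ht : polTerm d k (P w) = 2 / w := by
    simp [polTerm, hd, hz]
  rw [ht, hone, ← hz]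
  simp only [u]
  have hz2 : ((P w : planeMinusIntegers) : ℂ) - pole k = w / 2 := by rw [hz]; ring
  rw [hz2]
  change _ = _ / ((f.1 (P w) : ℂ) * ((1 + 2 / (w : ℂ)) * prodF d' (P w)) / _)
  have n5 : 1 + 2 / (w : ℂ) ≠ 0 := by
    intro h0; field_simp at h0; exact n4 (by simpa using h0)
  generalize prodF d' (P w) = A at *
  generalize prodF e (P w) = B at *
  generalize (f.1 (P w) : ℂ) = C at *
  generalize (w : ℂ) = v at *
  have : 1 + 2 / v = (v + 2) / v := by field_simp
  rw [this]
  field_simp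

lemma pert_inj (f : HoloMaps) :
    Function.Injective (fun d => (Quotient.mk (pathSetoid HoloMaps) (pert f d))) := by
  intro d e h
  have hj : Joined (pert f d) (pert f e) := Quotient.exact h
  by_contra hne
  obtain ⟨k, hk⟩ := Function.ne_iff.mp hne
  cases hd : d k <;> cases he : e k
  · simp [hd, he] at hk
  · exact not_joined_s1 f e d k he hd hj
  · exact not_joined_s1 f d e k hd he hj.symm
  · simp [hd, he] at hk

lemma not_countable_bool : ¬ Countable (ℕ → Bool) := by
  intro h
  obtain ⟨g, hg⟩ := exists_surjective_nat (ℕ → Bool)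
  obtain ⟨n, hn⟩ := hg (fun m => !(g m m))
  have := congrFun hn n
  simp at this

lemma main_uncountable (W : Set HoloMaps) (hW : IsOpen W) (hne : W.Nonempty) :
    ¬ Countable (Quotient.mk (pathSetoid HoloMaps) '' W : Set (ZerothHomotopy HoloMaps)) := by
  intro hc
  obtain ⟨f, hf⟩ := hne
  have ho : IsOpen (pert f ⁻¹' W) := hW.preimage (pert_cont f)
  have hm : (fun _ => false) ∈ pert f ⁻¹' W := by
    rw [Set.mem_preimage, pert_zero]; exact hf
  obtain ⟨I, v, hv, hsub⟩ := isOpen_pi_iff.mp ho _ hm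
  obtain ⟨N, hN⟩ : ∃ N : ℕ, ∀ i ∈ I, i < N := ⟨I.sup id + 1, fun i hi =>
    Nat.lt_succ_of_le (Finset.le_sup (f := id) hi)⟩
  let s : (ℕ → Bool) → (ℕ → Bool) := fun d j => if j < N then false else d (j - N)
  have hs : Function.Injective s := by
    intro a b hab
    ext j
    have := congrFun hab (j + N)
    simpa [s] using this
  have hsW : ∀ d, pert f (s d) ∈ W := by
    intro d
    apply hsub
    intro i hi
    have h1 := (hv i hi).2
    have h2 := hN i hi
    simpa [s, h2] using h1
  apply not_countable_bool
  let F : (ℕ → Bool) → (Quotient.mk (pathSetoid HoloMaps) '' W : Set (ZerothHomotopy HoloMaps)) :=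
    fun d => ⟨Quotient.mk _ (pert f (s d)), _, hsW d, rfl⟩
  have hF : Function.Injective F := by
    intro a b hab
    exact hs (pert_inj f (congrArg Subtype.val hab))
  exact hF.countable

/-- in the space `A = O(ℂ ∖ ℤ, ℂ ∖ {0})` of holomorphic maps with the
compact-open topology, every nonempty open subset meets uncountably many path
components of `A`; consequently no nonempty open subset of `A` is contractible
within `A` (i.e. the inclusion is not homotopic to a constant map). -/
theorem stmt_1 (W : Set HoloMaps) (hW : IsOpen W) (hne : W.Nonempty) :
    ¬ Countable (Quotient.mk (pathSetoid HoloMaps) '' W : Set (ZerothHomotopy HoloMaps)) ∧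
    ∀ y : HoloMaps,
      ¬ ContinuousMap.Homotopic
          (⟨Subtype.val, continuous_subtype_val⟩ : C(W, HoloMaps))
          (ContinuousMap.const W y) := by
  refine ⟨main_uncountable W hW hne, ?_⟩
  rintro y ⟨H⟩
  apply main_uncountable W hW hne
  have hj : ∀ w : W, Joined w.1 y := by
    intro w
    refine ⟨⟨⟨fun t => H (t, w), by fun_prop⟩, ?_, ?_⟩⟩
    · simp
    · simp
  have : (Quotient.mk (pathSetoid HoloMaps) '' W : Set (ZerothHomotopy HoloMaps)).Subsingleton := by
    rintro _ ⟨a, ha, rfl⟩ _ ⟨b, hb, rfl⟩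
    exact Quotient.sound ((hj ⟨a, ha⟩).trans (hj ⟨b, hb⟩).symm)
  exact this.countable
end
end
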